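/- arXiv:1405.1840 — 5 statements merged into one kernel-verified Lean document; each statement's English description precedes it below -/
import Mathlib

section
/- Let (𝓑; B₁, B₂) be a boundary triplet for A₀* and let A be the restriction of A₀* to a subspace 𝓓 with Ker(B₁) ∩ Ker(B₂) ⊆ 𝓓 ⊆ dom(A₀*), and set 𝓒 := {(B₁d, B₂d) : d ∈ 𝓓}. Then the operator closure of A (as an unbounded operator on X) is the restriction of A₀* to 𝓓̃ := { d ∈ dom(A₀*) : (B₁d, B₂d) ∈ cl(𝓒) }, where cl(𝓒) is the closure of 𝓒 in 𝓑 × 𝓑. Moreover 𝓓̃ equals the closure of 𝓓 in dom(A₀*) endowed with the graph norm of A₀*, and A is a closed operator if and only if 𝓒 is a closed subspace of 𝓑 × 𝓑. -/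
open scoped ComplexInnerProductSpace

noncomputable section

/-- A boundary triplet `(𝓑; B₁, B₂)` for the operator `T` (to be taken as `T = A₀*`):
a Hilbert space `B` and two linear maps `B₁ B₂ : dom T → B`, bounded with respect to the
graph norm of `T`, such that `x ↦ (B₁ x, B₂ x)` is onto `B × B` and the abstract Green
identity `⟪Tx, x̃⟫ + ⟪x, Tx̃⟫ = ⟪B₁x, B₂x̃⟫ + ⟪B₂x, B₁x̃⟫` holds. -/
structure BoundaryTriplet {X : Type*} [NormedAddCommGroup X] [InnerProductSpace ℂ X]
    (B : Type*) [NormedAddCommGroup B] [InnerProductSpace ℂ B]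
    (T : X →ₗ.[ℂ] X) where
  B₁ : T.domain →ₗ[ℂ] B
  B₂ : T.domain →ₗ[ℂ] B
  bounded₁ : ∃ C : ℝ, ∀ x : T.domain, ‖B₁ x‖ ≤ C * (‖(x : X)‖ + ‖T x‖)
  bounded₂ : ∃ C : ℝ, ∀ x : T.domain, ‖B₂ x‖ ≤ C * (‖(x : X)‖ + ‖T x‖)
  surjective : Function.Surjective fun x : T.domain => (B₁ x, B₂ x)
  green : ∀ x y : T.domain,
    ⟪T x, (y : X)⟫ + ⟪(x : X), T y⟫ = ⟪B₁ x, B₂ y⟫ + ⟪B₂ x, B₁ y⟫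

section GraphNormClosure

variable {V E W : Type*} [AddCommGroup V] [Module ℂ V]
  [NormedAddCommGroup E] [NormedSpace ℂ E] [CompleteSpace E]
  [NormedAddCommGroup W] [NormedSpace ℂ W] [CompleteSpace W]

/-- If `V` carries the complete norm `‖g ·‖` and `Γ` is bounded and onto, then `Γ` is open, so
taking the closure commutes with the preimage under `Γ`. -/
theorem comap_closure_map_eq_comap_closure_map {g : V →ₗ[ℂ] E} {Γ : V →ₗ[ℂ] W}
    (hg : Function.Injective g) (hrange : IsClosed (LinearMap.range g : Set E))
    (hΓ : Function.Surjective Γ) (hbound : ∃ C : ℝ, ∀ v, ‖Γ v‖ ≤ C * ‖g v‖)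
    {P : Submodule ℂ V} (hP : LinearMap.ker Γ ≤ P) :
    (P.map Γ).topologicalClosure.comap Γ = (P.map g).topologicalClosure.comap g := by
  have : CompleteSpace (LinearMap.range g) := hrange.completeSpace_coe
  let e := LinearEquiv.ofInjective g hg
  obtain ⟨C, hC⟩ := hbound
  let Φ : LinearMap.range g →L[ℂ] W :=
    (Γ ∘ₗ e.symm.toLinearMap).mkContinuous C fun y => by
      obtain ⟨v, rfl⟩ := e.surjective y
      simpa [e] using hC v
  have hΦe (v : V) : Φ (e v) = Γ v := by simp [Φ]
  have hsurj : Function.Surjective Φ := fun w => by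
    obtain ⟨v, rfl⟩ := hΓ w
    exact ⟨e v, hΦe v⟩
  have hpre : Subtype.val '' (Φ ⁻¹' (P.map Γ : Set W)) = (P.map g : Set E) := by
    ext x
    constructor
    · rintro ⟨y, ⟨p, hp, hpy⟩, rfl⟩
      obtain ⟨v, rfl⟩ := e.surjective y
      rw [hΦe] at hpy
      have hv : v - p ∈ P := hP (by simp [hpy])
      exact ⟨v, by simpa using P.add_mem hv hp, rfl⟩
    · rintro ⟨p, hp, rfl⟩
      exact ⟨e p, ⟨p, hp, (hΦe p).symm⟩, rfl⟩
  ext v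
  have hopen := (Φ.isOpenMap hsurj).preimage_closure_eq_closure_preimage Φ.continuous
    (P.map Γ : Set W)
  have h := Set.ext_iff.mp hopen (e v)
  rw [closure_subtype, hpre, Set.mem_preimage, hΦe] at h
  exact h

theorem isClosed_map_iff_isClosed_map {g : V →ₗ[ℂ] E} {Γ : V →ₗ[ℂ] W}
    (hg : Function.Injective g) (hrange : IsClosed (LinearMap.range g : Set E))
    (hΓ : Function.Surjective Γ) (hbound : ∃ C : ℝ, ∀ v, ‖Γ v‖ ≤ C * ‖g v‖)
    {P : Submodule ℂ V} (hP : LinearMap.ker Γ ≤ P) :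
    IsClosed (P.map g : Set E) ↔ IsClosed (P.map Γ : Set W) := by
  have key := comap_closure_map_eq_comap_closure_map hg hrange hΓ hbound hP
  constructor
  · intro h
    rw [h.submodule_topologicalClosure_eq, Submodule.comap_map_eq_of_injective hg] at key
    rw [← key, Submodule.map_comap_eq_of_surjective hΓ]
    exact Submodule.isClosed_topologicalClosure _
  · intro h
    rw [h.submodule_topologicalClosure_eq, Submodule.comap_map_eq_self hP] at key
    have hle : (P.map g).topologicalClosure ≤ LinearMap.range g :=
      Submodule.topologicalClosure_minimal _ LinearMap.map_le_range hrange
    rw [key, Submodule.map_comap_eq_self hle]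
    exact Submodule.isClosed_topologicalClosure _

end GraphNormClosure

theorem LinearPMap.graph_domRestrict_map_subtype {X Y : Type*} [AddCommGroup X] [Module ℂ X]
    [AddCommGroup Y] [Module ℂ Y] (T : X →ₗ.[ℂ] Y) (P : Submodule ℂ T.domain) :
    (T.domRestrict (P.map T.domain.subtype)).graph = P.map (T.domain.subtype.prod T.toFun) := by
  ext ⟨x, y⟩
  rw [LinearPMap.mem_graph_iff]
  constructor
  · rintro ⟨⟨_, ⟨d, hd, rfl⟩, hx⟩, rfl, rfl⟩
    exact ⟨d, hd, Prod.ext rfl (LinearPMap.domRestrict_apply rfl).symm⟩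
  · rintro ⟨d, hd, h⟩
    obtain ⟨rfl, rfl⟩ := Prod.ext_iff.mp h
    exact ⟨⟨d, ⟨d, hd, rfl⟩, d.2⟩, rfl, LinearPMap.domRestrict_apply rfl⟩

theorem LinearPMap.graph_eq_range {X Y : Type*} [AddCommGroup X] [Module ℂ X]
    [AddCommGroup Y] [Module ℂ Y] (T : X →ₗ.[ℂ] Y) :
    T.graph = LinearMap.range (T.domain.subtype.prod T.toFun) := by
  ext ⟨x, y⟩
  simp [LinearPMap.mem_graph_iff, Prod.ext_iff]

theorem BoundaryTriplet.exists_bound {X : Type*} [NormedAddCommGroup X] [InnerProductSpace ℂ X]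
    {B : Type*} [NormedAddCommGroup B] [InnerProductSpace ℂ B] {T : X →ₗ.[ℂ] X}
    (BT : BoundaryTriplet B T) :
    ∃ C : ℝ, ∀ x, ‖BT.B₁.prod BT.B₂ x‖ ≤ C * ‖T.domain.subtype.prod T.toFun x‖ := by
  obtain ⟨C₁, h₁⟩ := BT.bounded₁
  obtain ⟨C₂, h₂⟩ := BT.bounded₂
  refine ⟨max |C₁| |C₂| * 2, fun x => ?_⟩
  have hx : ‖(x : X)‖ + ‖T x‖ ≤ 2 * ‖T.domain.subtype.prod T.toFun x‖ := by
    have h := norm_fst_le (T.domain.subtype.prod T.toFun x)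
    have h' := norm_snd_le (T.domain.subtype.prod T.toFun x)
    change ‖(x : X)‖ ≤ _ at h
    change ‖T x‖ ≤ _ at h'
    linarith
  have hle {C : ℝ} (hC : C ≤ max |C₁| |C₂|) :
      C * (‖(x : X)‖ + ‖T x‖) ≤ max |C₁| |C₂| * 2 * ‖T.domain.subtype.prod T.toFun x‖ := by
    rw [mul_assoc]
    gcongr
  exact max_le ((h₁ x).trans (hle ((le_abs_self _).trans (le_max_left _ _))))
    ((h₂ x).trans (hle ((le_abs_self _).trans (le_max_right _ _))))

/-- With `A` the restriction of `A₀*` to `𝓓 ⊇ ker B₁ ∩ ker B₂` and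
`𝓒 := {(B₁ d, B₂ d) : d ∈ 𝓓}`, the operator closure of `A` is the restriction of `A₀*` to
`𝓓̃ = {d ∈ dom A₀* : (B₁ d, B₂ d) ∈ cl 𝓒}`; moreover `𝓓̃` is the closure of `𝓓` in the graph
norm of `A₀*` (realised via the embedding `g : d ↦ (d, A₀* d)` into `X × X`), and `A` is
closed iff `𝓒` is closed in `𝓑 × 𝓑`. -/
theorem statement1
    {X : Type*} [NormedAddCommGroup X] [InnerProductSpace ℂ X] [CompleteSpace X]
    {B : Type*} [NormedAddCommGroup B] [InnerProductSpace ℂ B] [CompleteSpace B]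
    (A₀ : X →ₗ.[ℂ] X) (hdense : Dense (A₀.domain : Set X)) (hclosed : A₀.IsClosed)
    (hskew : ∀ x : A₀.domain, (⟪A₀ x, (x : X)⟫ : ℂ).re = 0)
    (BT : BoundaryTriplet B A₀.adjoint)
    (𝓓 : Submodule ℂ A₀.adjoint.domain)
    (h𝓓 : LinearMap.ker BT.B₁ ⊓ LinearMap.ker BT.B₂ ≤ 𝓓)
    (A : X →ₗ.[ℂ] X)
    (hA : A = A₀.adjoint.domRestrict (𝓓.map A₀.adjoint.domain.subtype))
    (𝓒 : Submodule ℂ (B × B)) (h𝓒 : 𝓒 = 𝓓.map (BT.B₁.prod BT.B₂))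
    (g : A₀.adjoint.domain →ₗ[ℂ] X × X)
    (hg : g = A₀.adjoint.domain.subtype.prod A₀.adjoint.toFun)
    (𝓓' : Submodule ℂ A₀.adjoint.domain)
    (h𝓓' : 𝓓' = Submodule.comap (BT.B₁.prod BT.B₂) 𝓒.topologicalClosure) :
    A.closure = A₀.adjoint.domRestrict (𝓓'.map A₀.adjoint.domain.subtype) ∧
      𝓓' = Submodule.comap g ((𝓓.map g).topologicalClosure) ∧
      (A.IsClosed ↔ IsClosed (𝓒 : Set (B × B))) := by
  subst hA h𝓒 hg h𝓓'
  have hT : A₀.adjoint.IsClosed := LinearPMap.adjoint_isClosed hdense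
  have hinj : Function.Injective (A₀.adjoint.domain.subtype.prod A₀.adjoint.toFun) :=
    fun x y h => Subtype.ext (Prod.ext_iff.mp h).1
  have hrange : IsClosed (LinearMap.range
      (A₀.adjoint.domain.subtype.prod A₀.adjoint.toFun) : Set (X × X)) := by
    rw [← LinearPMap.graph_eq_range]
    exact hT
  have hker : LinearMap.ker (BT.B₁.prod BT.B₂) ≤ 𝓓 := by rwa [LinearMap.ker_prod]
  have key := comap_closure_map_eq_comap_closure_map hinj hrange BT.surjective
    BT.exists_bound hker
  refine ⟨LinearPMap.eq_of_eq_graph ?_, key, ?_⟩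
  · rw [← (hT.isClosable.leIsClosable LinearPMap.domRestrict_le).graph_closure_eq_closure_graph,
      LinearPMap.graph_domRestrict_map_subtype, LinearPMap.graph_domRestrict_map_subtype, key,
      Submodule.map_comap_eq_self]
    exact Submodule.topologicalClosure_minimal _ LinearMap.map_le_range hrange
  · rw [LinearPMap.IsClosed, LinearPMap.graph_domRestrict_map_subtype]
    exact isClosed_map_iff_isClosed_map hinj hrange BT.surjective BT.exists_bound hker
end
end

section
/- Let (𝓑; B₁, B₂) be a boundary triplet for A₀* and let A be the restriction of A₀* to a subspace 𝓓 with Ker(B₁) ∩ Ker(B₂) ⊆ 𝓓 ⊆ dom(A₀*), and set 𝓒 := {(B₁d, B₂d) : d ∈ 𝓓}. Then the Hilbert-space adjoint A* of A is the restriction of −A₀* to 𝓓' := { d' ∈ dom(A₀*) : (B₂d', B₁d') ∈ 𝓒^⊥ }, where 𝓒^⊥ is the orthogonal complement of 𝓒 in 𝓑 × 𝓑; equivalently, (B₁d', B₂d') belongs to the image of 𝓒^⊥ under the coordinate flip (q,p) ↦ (p,q). -/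
open scoped ComplexInnerProductSpace

noncomputable section

/-- The orthogonal complement of a relation `C ⊆ H × H` with respect to the natural inner
product `⟪(f, e), (q, p)⟫ = ⟪f, q⟫ + ⟪e, p⟫` on `H × H`. -/
def prodOrth {H : Type*} [NormedAddCommGroup H] [InnerProductSpace ℂ H]
    (C : Submodule ℂ (H × H)) : Submodule ℂ (H × H) where
  carrier := {p | ∀ c ∈ C, (⟪c.1, p.1⟫ : ℂ) + ⟪c.2, p.2⟫ = 0}
  add_mem' := by
    intro a b ha hb c hc
    simp only [Set.mem_setOf_eq] at *
    rw [Prod.fst_add, Prod.snd_add, inner_add_right, inner_add_right]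
    linear_combination ha c hc + hb c hc
  zero_mem' := by
    intro c hc
    simp
  smul_mem' := by
    intro m p hp c hc
    simp only [Set.mem_setOf_eq] at *
    rw [Prod.smul_fst, Prod.smul_snd, inner_smul_right, inner_smul_right]
    linear_combination m * hp c hc

theorem LinearPMap.inner_add_inner_eq_zero_of_re_inner_self
    {X : Type*} [NormedAddCommGroup X] [InnerProductSpace ℂ X] {T : X →ₗ.[ℂ] X}
    (hT : ∀ x : T.domain, (⟪T x, (x : X)⟫ : ℂ).re = 0) (x y : T.domain) :
    ⟪T x, (y : X)⟫ + ⟪(x : X), T y⟫ = 0 := by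
  have re_eq (x y : T.domain) : (⟪T x, (y : X)⟫ + ⟪(x : X), T y⟫).re = 0 := by
    have h := hT (x + y)
    have hsymm : (⟪T y, (x : X)⟫ : ℂ).re = (⟪(x : X), T y⟫ : ℂ).re := inner_re_symm (𝕜 := ℂ) _ _
    simp only [LinearPMap.map_add, Submodule.coe_add, inner_add_left, inner_add_right,
      Complex.add_re, hT, hsymm] at h
    rw [Complex.add_re]
    linarith
  have h := re_eq x (Complex.I • y)
  rw [LinearPMap.map_smul, Submodule.coe_smul, inner_smul_right, inner_smul_right, ← mul_add,
    Complex.I_mul_re] at h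
  exact Complex.ext (re_eq x y) (neg_eq_zero.mp h)

theorem LinearPMap.neg_le_adjoint_of_re_inner_self
    {X : Type*} [NormedAddCommGroup X] [InnerProductSpace ℂ X] [CompleteSpace X]
    {T : X →ₗ.[ℂ] X} (hdense : Dense (T.domain : Set X))
    (hT : ∀ x : T.domain, (⟪T x, (x : X)⟫ : ℂ).re = 0) : -T ≤ T.adjoint := by
  refine LinearPMap.IsFormalAdjoint.le_adjoint hdense fun x y => ?_
  rw [LinearPMap.neg_apply, inner_neg_right]
  exact eq_neg_of_add_eq_zero_left (LinearPMap.inner_add_inner_eq_zero_of_re_inner_self hT x y)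

theorem BoundaryTriplet.mem_ker_of_green_eq_zero
    {X : Type*} [NormedAddCommGroup X] [InnerProductSpace ℂ X]
    {B : Type*} [NormedAddCommGroup B] [InnerProductSpace ℂ B] {T : X →ₗ.[ℂ] X}
    (BT : BoundaryTriplet B T) {x : T.domain}
    (hx : ∀ y : T.domain, ⟪T y, (x : X)⟫ + ⟪(y : X), T x⟫ = 0) :
    x ∈ LinearMap.ker BT.B₁ ⊓ LinearMap.ker BT.B₂ := by
  have key (p q : B) : ⟪p, BT.B₂ x⟫ + ⟪q, BT.B₁ x⟫ = 0 := by
    obtain ⟨y, hy⟩ := BT.surjective (p, q)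
    obtain ⟨rfl, rfl⟩ := Prod.mk.inj hy
    rw [← BT.green, hx]
  constructor
  · simpa using key 0 (BT.B₁ x)
  · simpa using key (BT.B₂ x) 0

/-- If `A₀` is skew-symmetric, its domain is annihilated by both boundary maps. -/
theorem BoundaryTriplet.domain_le_map_ker
    {X : Type*} [NormedAddCommGroup X] [InnerProductSpace ℂ X] [CompleteSpace X]
    {B : Type*} [NormedAddCommGroup B] [InnerProductSpace ℂ B]
    {A₀ : X →ₗ.[ℂ] X} (hdense : Dense (A₀.domain : Set X))
    (hskew : ∀ x : A₀.domain, (⟪A₀ x, (x : X)⟫ : ℂ).re = 0)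
    (BT : BoundaryTriplet B A₀.adjoint) :
    A₀.domain ≤
      (LinearMap.ker BT.B₁ ⊓ LinearMap.ker BT.B₂).map A₀.adjoint.domain.subtype := by
  have hle := LinearPMap.neg_le_adjoint_of_re_inner_self hdense hskew
  intro x hx
  refine ⟨⟨x, hle.1 hx⟩, BT.mem_ker_of_green_eq_zero fun y => ?_, rfl⟩
  rw [← @hle.2 ⟨x, hx⟩ ⟨x, hle.1 hx⟩ rfl, LinearPMap.neg_apply, inner_neg_right,
    LinearPMap.adjoint_isFormalAdjoint hdense y ⟨x, hx⟩, add_neg_cancel]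

/-- With `A` the restriction of `A₀*` to `𝓓 ⊇ ker B₁ ∩ ker B₂` and
`𝓒 := {(B₁ d, B₂ d) : d ∈ 𝓓}`, the Hilbert-space adjoint `A*` is the restriction of `−A₀*`
to `𝓓' = {d' ∈ dom A₀* : (B₂ d', B₁ d') ∈ 𝓒^⊥}`. -/
theorem statement2
    {X : Type*} [NormedAddCommGroup X] [InnerProductSpace ℂ X] [CompleteSpace X]
    {B : Type*} [NormedAddCommGroup B] [InnerProductSpace ℂ B] [CompleteSpace B]
    (A₀ : X →ₗ.[ℂ] X) (hdense : Dense (A₀.domain : Set X)) (hclosed : A₀.IsClosed)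
    (hskew : ∀ x : A₀.domain, (⟪A₀ x, (x : X)⟫ : ℂ).re = 0)
    (BT : BoundaryTriplet B A₀.adjoint)
    (𝓓 : Submodule ℂ A₀.adjoint.domain)
    (h𝓓 : LinearMap.ker BT.B₁ ⊓ LinearMap.ker BT.B₂ ≤ 𝓓)
    (A : X →ₗ.[ℂ] X)
    (hA : A = A₀.adjoint.domRestrict (𝓓.map A₀.adjoint.domain.subtype))
    (𝓒 : Submodule ℂ (B × B)) (h𝓒 : 𝓒 = 𝓓.map (BT.B₁.prod BT.B₂))
    (𝓓' : Submodule ℂ A₀.adjoint.domain)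
    (h𝓓' : 𝓓' = Submodule.comap (BT.B₂.prod BT.B₁) (prodOrth 𝓒)) :
    A.adjoint = (-A₀.adjoint).domRestrict (𝓓'.map A₀.adjoint.domain.subtype) := by
  subst hA h𝓒 h𝓓'
  have hle := LinearPMap.neg_le_adjoint_of_re_inner_self hdense hskew
  have hdom : A₀.domain ≤ 𝓓.map A₀.adjoint.domain.subtype :=
    (BT.domain_le_map_ker hdense hskew).trans (Submodule.map_mono h𝓓)
  set A := A₀.adjoint.domRestrict (𝓓.map A₀.adjoint.domain.subtype)
  have hA_dom : A₀.domain ≤ A.domain := le_inf hdom hle.1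
  have hA_dense : Dense (A.domain : Set X) := hdense.mono hA_dom
  have hA_mem (d : A₀.adjoint.domain) (hd : d ∈ 𝓓) : (d : X) ∈ A.domain := ⟨⟨d, hd, rfl⟩, d.2⟩
  have hA_apply (d : A₀.adjoint.domain) (hd : d ∈ 𝓓) : A ⟨d, hA_mem d hd⟩ = A₀.adjoint d :=
    LinearPMap.domRestrict_apply rfl
  refine le_antisymm ?_ (LinearPMap.IsFormalAdjoint.le_adjoint hA_dense ?_)
  · have h_formal (y : A.adjoint.domain) (x : A₀.domain) :
        ⟪-A.adjoint y, (x : X)⟫ = ⟪(y : X), A₀ x⟫ := by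
      have hAx : A ⟨x, hA_dom x.2⟩ = -A₀ x := by
        rw [← LinearPMap.neg_apply, @hle.2 x ⟨x, hle.1 x.2⟩ rfl]
        exact LinearPMap.domRestrict_apply rfl
      have h := LinearPMap.adjoint_isFormalAdjoint hA_dense y ⟨x, hA_dom x.2⟩
      rw [hAx, inner_neg_right] at h
      rw [inner_neg_left, h, neg_neg]
    have h_mem (y : A.adjoint.domain) : (y : X) ∈ A₀.adjoint.domain :=
      LinearPMap.mem_adjoint_domain_of_exists _ ⟨_, h_formal y⟩
    have h_apply (y : A.adjoint.domain) : A₀.adjoint ⟨y, h_mem y⟩ = -A.adjoint y :=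
      LinearPMap.adjoint_apply_eq hdense ⟨y, h_mem y⟩ (h_formal y)
    refine ⟨fun y hy => ⟨⟨⟨y, h_mem ⟨y, hy⟩⟩, ?_, rfl⟩, h_mem ⟨y, hy⟩⟩, fun y z hyz => ?_⟩
    · rintro _ ⟨d, hd, rfl⟩
      have h := (LinearPMap.adjoint_isFormalAdjoint hA_dense).symm ⟨d, hA_mem d hd⟩ ⟨y, hy⟩
      rw [hA_apply d hd] at h
      refine (BT.green d ⟨y, h_mem ⟨y, hy⟩⟩).symm.trans ?_
      rw [h_apply ⟨y, hy⟩, h, inner_neg_right, add_neg_cancel]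
    · rw [LinearPMap.domRestrict_apply (f := -A₀.adjoint) (y := ⟨y, h_mem y⟩) hyz.symm,
        LinearPMap.neg_apply, h_apply, neg_neg]
  · rintro ⟨x, hx⟩ ⟨y, hy⟩
    obtain ⟨d, hd, hdx⟩ := hx.1
    obtain ⟨d', h_orth, hdy⟩ := hy.1
    have hAx : A ⟨x, hx⟩ = A₀.adjoint d := LinearPMap.domRestrict_apply hdx.symm
    have hAy := LinearPMap.domRestrict_apply (f := -A₀.adjoint) (x := ⟨y, hy⟩) (y := d') hdy.symm
    refine (congrArg₂ (inner ℂ) hAx hdy.symm).trans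
      (.trans ?_ (congrArg₂ (inner ℂ) hdx hAy.symm))
    rw [LinearPMap.neg_apply, inner_neg_right]
    exact eq_neg_of_add_eq_zero_left ((BT.green d d').trans (h_orth _ ⟨d, hd, rfl⟩))
end
end

section
/- Let (𝓑; B₁, B₂) be a boundary triplet for A₀* and let A be the restriction of A₀* to a subspace 𝓓 with Ker(B₁) ∩ Ker(B₂) ⊆ 𝓓 ⊆ dom(A₀*), and set 𝓒 := {(B₁d, B₂d) : d ∈ 𝓓}. Then A is accretive if and only if 𝓒 is an accretive relation in 𝓑, A is maximal accretive if and only if 𝓒 is maximal accretive, and A is skew-symmetric (Re⟨Ax, x⟩_X = 0 for all x ∈ dom(A)) if and only if 𝓒 is a skew-symmetric relation (Re⟨f, e⟩_𝓑 = 0 for all (f, e) ∈ 𝓒). -/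
open scoped ComplexInnerProductSpace

noncomputable section

/-- A relation `R` in a Hilbert space `H` is accretive if `Re ⟪r₁, r₂⟫ ≥ 0` for all
`(r₁, r₂) ∈ R`. -/
def IsAccretiveRel {H : Type*} [NormedAddCommGroup H] [InnerProductSpace ℂ H]
    (R : Submodule ℂ (H × H)) : Prop :=
  ∀ r ∈ R, 0 ≤ (⟪r.1, r.2⟫ : ℂ).re

/-- A relation is maximal accretive if it is accretive and has no proper accretive
extension. -/
def IsMaximalAccretiveRel {H : Type*} [NormedAddCommGroup H] [InnerProductSpace ℂ H]
    (R : Submodule ℂ (H × H)) : Prop :=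
  IsAccretiveRel R ∧
    ∀ R' : Submodule ℂ (H × H), IsAccretiveRel R' → R ≤ R' → R' = R

/-- A relation `R` is skew-symmetric if `Re ⟪r₁, r₂⟫ = 0` for all `(r₁, r₂) ∈ R`. -/
def IsSkewSymmetricRel {H : Type*} [NormedAddCommGroup H] [InnerProductSpace ℂ H]
    (R : Submodule ℂ (H × H)) : Prop :=
  ∀ r ∈ R, (⟪r.1, r.2⟫ : ℂ).re = 0

/-- The linear map `x ↦ (x, T x)` from the domain of `T` onto its graph. -/
def LinearPMap.graphMap {X : Type*} [NormedAddCommGroup X] [InnerProductSpace ℂ X]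
    (T : X →ₗ.[ℂ] X) : T.domain →ₗ[ℂ] X × X :=
  T.domain.subtype.prod T.toFun

lemma LinearPMap.graphMap_apply {X : Type*} [NormedAddCommGroup X] [InnerProductSpace ℂ X]
    (T : X →ₗ.[ℂ] X) (x : T.domain) : T.graphMap x = ((x : X), T x) := rfl

lemma LinearPMap.graph_domRestrict_map {X : Type*} [NormedAddCommGroup X]
    [InnerProductSpace ℂ X] (T : X →ₗ.[ℂ] X) (D : Submodule ℂ T.domain) :
    (T.domRestrict (D.map T.domain.subtype)).graph = D.map T.graphMap := by
  ext ⟨a, b⟩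
  rw [LinearPMap.mem_graph_iff, Submodule.mem_map]
  constructor
  · rintro ⟨⟨y, hy⟩, rfl, rfl⟩
    obtain ⟨⟨d, hd, rfl⟩, -⟩ := Submodule.mem_inf.mp hy
    exact ⟨d, hd, Prod.ext rfl (T.domRestrict_apply (x := ⟨_, hy⟩) (y := d) rfl).symm⟩
  · rintro ⟨d, hd, h⟩
    have hy : (d : X) ∈ D.map T.domain.subtype ⊓ T.domain := ⟨⟨d, hd, rfl⟩, d.2⟩
    obtain ⟨rfl, rfl⟩ := Prod.ext_iff.mp h
    exact ⟨⟨d, hy⟩, rfl, T.domRestrict_apply (x := ⟨_, hy⟩) (y := d) rfl⟩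

/-- In an accretive relation, an element on which the quadratic form vanishes is orthogonal to
the whole relation with respect to the associated sesquilinear form. -/
lemma IsAccretiveRel.inner_add_inner_eq_zero {H : Type*} [NormedAddCommGroup H]
    [InnerProductSpace ℂ H] {R : Submodule ℂ (H × H)} (hR : IsAccretiveRel R) {u v : H × H}
    (hu : u ∈ R) (hv : v ∈ R) (hv0 : (⟪v.1, v.2⟫ : ℂ).re = 0) :
    ⟪u.1, v.2⟫ + ⟪u.2, v.1⟫ = 0 := by
  set w : ℂ := ⟪u.1, v.2⟫ + ⟪u.2, v.1⟫ with hw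
  have key : ∀ z : ℂ, 0 ≤ (⟪u.1, u.2⟫ : ℂ).re + (z * w).re := by
    intro z
    have h := hR _ (R.add_mem hu (R.smul_mem z hv))
    have hsymm : (starRingEnd ℂ z * ⟪v.1, u.2⟫).re = (z * ⟪u.2, v.1⟫).re := by
      rw [← Complex.conj_re, map_mul, Complex.conj_conj, inner_conj_symm]
    have hzero : (z * (starRingEnd ℂ z * ⟪v.1, v.2⟫)).re = 0 := by
      rw [mul_left_comm, ← mul_assoc, ← Complex.normSq_eq_conj_mul_self, Complex.re_ofReal_mul, hv0, mul_zero]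
    simp only [Prod.fst_add, Prod.snd_add, Prod.smul_fst, Prod.smul_snd, inner_add_left,
      inner_add_right, inner_smul_left, inner_smul_right, mul_add, Complex.add_re, hsymm, hzero] at h
    rw [hw, mul_add, Complex.add_re]
    linarith
  by_contra hne
  have hpos : 0 < Complex.normSq w := Complex.normSq_pos.mpr hne
  have h := key (-((((⟪u.1, u.2⟫ : ℂ).re + 1) / Complex.normSq w : ℝ) : ℂ) * starRingEnd ℂ w)
  rw [mul_assoc, ← Complex.normSq_eq_conj_mul_self, ← Complex.ofReal_neg, ← Complex.ofReal_mul,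
    Complex.ofReal_re, neg_mul, div_mul_cancel₀ _ hpos.ne'] at h
  linarith

lemma LinearPMap.mem_graph_adjoint_of_inner {X : Type*} [NormedAddCommGroup X]
    [InnerProductSpace ℂ X] [CompleteSpace X] {T : X →ₗ.[ℂ] X}
    (hT : Dense (T.domain : Set X)) {x y : X} (h : ∀ z : T.domain, ⟪y, (z : X)⟫ = ⟪x, T z⟫) :
    ∃ d : T.adjoint.domain, (d : X) = x ∧ T.adjoint d = y := by
  have hx : x ∈ T.adjoint.domain := LinearPMap.mem_adjoint_domain_of_exists x ⟨y, h⟩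
  exact ⟨⟨x, hx⟩, rfl, LinearPMap.adjoint_apply_eq hT ⟨x, hx⟩ h⟩

/-- The quadratic forms of `T` and of the boundary maps have the same real part. -/
lemma BoundaryTriplet.re_inner_eq {X : Type*} [NormedAddCommGroup X] [InnerProductSpace ℂ X]
    {B : Type*} [NormedAddCommGroup B] [InnerProductSpace ℂ B] {T : X →ₗ.[ℂ] X}
    (BT : BoundaryTriplet B T) (x : T.domain) :
    (⟪(x : X), T x⟫ : ℂ).re = (⟪BT.B₁ x, BT.B₂ x⟫ : ℂ).re := by
  have h := congrArg Complex.re (BT.green x x)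
  have h₁ : (⟪T x, (x : X)⟫ : ℂ).re = (⟪(x : X), T x⟫ : ℂ).re := inner_re_symm (𝕜 := ℂ) _ _
  have h₂ : (⟪BT.B₂ x, BT.B₁ x⟫ : ℂ).re = (⟪BT.B₁ x, BT.B₂ x⟫ : ℂ).re :=
    inner_re_symm (𝕜 := ℂ) _ _
  rw [Complex.add_re, Complex.add_re, h₁, h₂] at h
  linarith

/-- `-A₀` is a restriction of `A₀*` to a subspace of the common kernel of the boundary maps. -/
lemma BoundaryTriplet.exists_mem_ker {X : Type*} [NormedAddCommGroup X]
    [InnerProductSpace ℂ X] [CompleteSpace X] {B : Type*} [NormedAddCommGroup B]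
    [InnerProductSpace ℂ B] {A₀ : X →ₗ.[ℂ] X} (hdense : Dense (A₀.domain : Set X))
    (hskew : ∀ x : A₀.domain, (⟪A₀ x, (x : X)⟫ : ℂ).re = 0)
    (BT : BoundaryTriplet B A₀.adjoint) (x : A₀.domain) :
    ∃ d ∈ LinearMap.ker BT.B₁ ⊓ LinearMap.ker BT.B₂, (d : X) = x ∧ A₀.adjoint d = -A₀ x := by
  have hskew' (z : A₀.domain) : (⟪(z : X), A₀ z⟫ : ℂ).re = 0 :=
    (inner_re_symm (𝕜 := ℂ) _ _).trans (hskew z)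
  have hacc : IsAccretiveRel A₀.graph := by
    rintro ⟨a, b⟩ hr
    obtain ⟨z, rfl, rfl⟩ := (LinearPMap.mem_graph_iff A₀).mp hr
    exact (hskew' z).ge
  obtain ⟨d, hdx, hd⟩ := LinearPMap.mem_graph_adjoint_of_inner (x := (x : X)) (y := -A₀ x)
    hdense fun z => by
      have h := hacc.inner_add_inner_eq_zero (A₀.mem_graph x) (A₀.mem_graph z) (hskew' z)
      rw [inner_neg_left]
      exact (eq_neg_of_add_eq_zero_left h).symm
  have hgreen (y : A₀.adjoint.domain) : ⟪BT.B₁ d, BT.B₂ y⟫ + ⟪BT.B₂ d, BT.B₁ y⟫ = (0 : ℂ) := by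
    have h : ⟪A₀.adjoint y, (x : X)⟫ = ⟪(y : X), A₀ x⟫ :=
      LinearPMap.adjoint_isFormalAdjoint hdense y x
    rw [← BT.green, hdx, hd, inner_neg_left, ← inner_conj_symm (x : X), h, inner_conj_symm,
      neg_add_cancel]
  obtain ⟨y, hy⟩ := BT.surjective (BT.B₂ d, BT.B₁ d)
  obtain ⟨hy₁, hy₂⟩ := Prod.ext_iff.mp hy
  have h := congrArg Complex.re (hgreen y)
  simp only at hy₁ hy₂
  rw [hy₁, hy₂, Complex.add_re, Complex.zero_re] at h
  have h₁ : 0 ≤ (⟪BT.B₁ d, BT.B₁ d⟫ : ℂ).re := inner_self_nonneg (𝕜 := ℂ)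
  have h₂ : 0 ≤ (⟪BT.B₂ d, BT.B₂ d⟫ : ℂ).re := inner_self_nonneg (𝕜 := ℂ)
  refine ⟨d, ⟨?_, ?_⟩, hdx, hd⟩
  · refine re_inner_self_nonpos (𝕜 := ℂ).mp ?_
    change (⟪BT.B₁ d, BT.B₁ d⟫ : ℂ).re ≤ 0
    linarith
  · refine re_inner_self_nonpos (𝕜 := ℂ).mp ?_
    change (⟪BT.B₂ d, BT.B₂ d⟫ : ℂ).re ≤ 0
    linarith

/-- The accretivity of a restriction of `T` is that of the boundary relation. -/
lemma BoundaryTriplet.isAccretiveRel_map_iff {X : Type*} [NormedAddCommGroup X]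
    [InnerProductSpace ℂ X] {B : Type*} [NormedAddCommGroup B] [InnerProductSpace ℂ B]
    {T : X →ₗ.[ℂ] X} (BT : BoundaryTriplet B T) (D : Submodule ℂ T.domain) :
    IsAccretiveRel (D.map T.graphMap) ↔ IsAccretiveRel (D.map (BT.B₁.prod BT.B₂)) := by
  have h (d : T.domain) := BT.re_inner_eq d
  unfold IsAccretiveRel
  constructor
  · rintro hD _ ⟨d, hd, rfl⟩
    have := hD _ ⟨d, hd, rfl⟩
    rwa [T.graphMap_apply, h] at this
  · rintro hD _ ⟨d, hd, rfl⟩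
    have := hD _ ⟨d, hd, rfl⟩
    rwa [T.graphMap_apply, h]

lemma BoundaryTriplet.isSkewSymmetricRel_map_iff {X : Type*} [NormedAddCommGroup X]
    [InnerProductSpace ℂ X] {B : Type*} [NormedAddCommGroup B] [InnerProductSpace ℂ B]
    {T : X →ₗ.[ℂ] X} (BT : BoundaryTriplet B T) (D : Submodule ℂ T.domain) :
    IsSkewSymmetricRel (D.map T.graphMap) ↔ IsSkewSymmetricRel (D.map (BT.B₁.prod BT.B₂)) := by
  have h (d : T.domain) := BT.re_inner_eq d
  unfold IsSkewSymmetricRel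
  constructor
  · rintro hD _ ⟨d, hd, rfl⟩
    have := hD _ ⟨d, hd, rfl⟩
    rwa [T.graphMap_apply, h] at this
  · rintro hD _ ⟨d, hd, rfl⟩
    have := hD _ ⟨d, hd, rfl⟩
    rwa [T.graphMap_apply, h]

lemma LinearPMap.isSkewSymmetricRel_graph_iff {X : Type*} [NormedAddCommGroup X]
    [InnerProductSpace ℂ X] (A : X →ₗ.[ℂ] X) :
    IsSkewSymmetricRel A.graph ↔ ∀ x : A.domain, (⟪A x, (x : X)⟫ : ℂ).re = 0 := by
  constructor
  · intro h x
    exact (inner_re_symm (𝕜 := ℂ) _ _).trans (h _ (A.mem_graph x))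
  · rintro h ⟨a, b⟩ hr
    obtain ⟨z, rfl, rfl⟩ := (LinearPMap.mem_graph_iff A).mp hr
    exact (inner_re_symm (𝕜 := ℂ) _ _).trans (h z)

/-- With `A` the restriction of `A₀*` to `𝓓 ⊇ ker B₁ ∩ ker B₂` and
`𝓒 := {(B₁ d, B₂ d) : d ∈ 𝓓}`: `A` is (maximal) accretive iff `𝓒` is (maximal) accretive,
and `A` is skew-symmetric iff `𝓒` is a skew-symmetric relation. -/
theorem statement5
    {X : Type*} [NormedAddCommGroup X] [InnerProductSpace ℂ X] [CompleteSpace X]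
    {B : Type*} [NormedAddCommGroup B] [InnerProductSpace ℂ B] [CompleteSpace B]
    (A₀ : X →ₗ.[ℂ] X) (hdense : Dense (A₀.domain : Set X)) (hclosed : A₀.IsClosed)
    (hskew : ∀ x : A₀.domain, (⟪A₀ x, (x : X)⟫ : ℂ).re = 0)
    (BT : BoundaryTriplet B A₀.adjoint)
    (𝓓 : Submodule ℂ A₀.adjoint.domain)
    (h𝓓 : LinearMap.ker BT.B₁ ⊓ LinearMap.ker BT.B₂ ≤ 𝓓)
    (A : X →ₗ.[ℂ] X)
    (hA : A = A₀.adjoint.domRestrict (𝓓.map A₀.adjoint.domain.subtype))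
    (𝓒 : Submodule ℂ (B × B)) (h𝓒 : 𝓒 = 𝓓.map (BT.B₁.prod BT.B₂)) :
    (IsAccretiveRel A.graph ↔ IsAccretiveRel 𝓒) ∧
      (IsMaximalAccretiveRel A.graph ↔ IsMaximalAccretiveRel 𝓒) ∧
      ((∀ x : A.domain, (⟪A x, (x : X)⟫ : ℂ).re = 0) ↔ IsSkewSymmetricRel 𝓒) := by
  subst hA h𝓒
  rw [← LinearPMap.isSkewSymmetricRel_graph_iff, LinearPMap.graph_domRestrict_map]
  refine ⟨BT.isAccretiveRel_map_iff 𝓓, ?_, BT.isSkewSymmetricRel_map_iff 𝓓⟩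
  have hinj : Function.Injective A₀.adjoint.graphMap := fun a b h =>
    Subtype.ext (congrArg Prod.fst h)
  constructor
  · rintro ⟨hacc, hmax⟩
    refine ⟨(BT.isAccretiveRel_map_iff 𝓓).mp hacc, fun R hR hle => ?_⟩
    have hsurj : Function.Surjective (BT.B₁.prod BT.B₂) := BT.surjective
    have hmap := Submodule.map_comap_eq_of_surjective hsurj R
    have h := hmax ((R.comap (BT.B₁.prod BT.B₂)).map A₀.adjoint.graphMap)
      ((BT.isAccretiveRel_map_iff _).mpr (hmap.symm ▸ hR))
      (Submodule.map_mono (Submodule.map_le_iff_le_comap.mp hle))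
    rw [← hmap, Submodule.map_injective_of_injective hinj h]
  · rintro ⟨hacc, hmax⟩
    refine ⟨(BT.isAccretiveRel_map_iff 𝓓).mpr hacc, fun R hR hle => ?_⟩
    have hrange : R ≤ LinearMap.range A₀.adjoint.graphMap := by
      rintro ⟨x, y⟩ hxy
      obtain ⟨d, rfl, rfl⟩ := LinearPMap.mem_graph_adjoint_of_inner (x := x) (y := y) hdense
        fun z => by
          obtain ⟨d, hdker, hdz, hd⟩ := BT.exists_mem_ker hdense hskew z
          have hmem : ((z : X), -A₀ z) ∈ R :=
            hle ⟨d, h𝓓 hdker, by rw [LinearPMap.graphMap_apply, hdz, hd]⟩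
          have h := hR.inner_add_inner_eq_zero hxy hmem (by
            have h : (⟪(z : X), A₀ z⟫ : ℂ).re = 0 :=
              (inner_re_symm (𝕜 := ℂ) _ _).trans (hskew z)
            rw [inner_neg_right, Complex.neg_re, h, neg_zero])
          simp only [inner_neg_right] at h
          exact (neg_add_eq_zero.mp h).symm
      exact ⟨d, rfl⟩
    have hmap : (R.comap A₀.adjoint.graphMap).map A₀.adjoint.graphMap = R :=
      Submodule.map_comap_eq_self hrange
    have hle' : 𝓓 ≤ R.comap A₀.adjoint.graphMap := Submodule.map_le_iff_le_comap.mp hle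
    have h := hmax ((R.comap A₀.adjoint.graphMap).map (BT.B₁.prod BT.B₂))
      ((BT.isAccretiveRel_map_iff _).mp (hmap.symm ▸ hR)) (Submodule.map_mono hle')
    have hker : LinearMap.ker (BT.B₁.prod BT.B₂) ≤ 𝓓 := by rwa [LinearMap.ker_prod]
    have heq := congrArg (Submodule.comap (BT.B₁.prod BT.B₂)) h
    rw [Submodule.comap_map_eq_self hker, Submodule.comap_map_eq_self (hker.trans hle')] at heq
    rw [← hmap, heq]
end
end

section
/- Let (𝓑; B₁, B₂) be a boundary triplet for A₀*, let 𝓚 be a Hilbert space, let W₁, W₂ ∈ 𝓛(𝓑; 𝓚) be bounded, and let A := A₀*|_{dom(A)} with dom(A) = { x ∈ dom(A₀*) : W₁B₁x + W₂B₂x = 0 }. Then A is dissipative if and only if Ker(W_B) := { (f, e) ∈ 𝓑 × 𝓑 : W₁f + W₂e = 0 } is a dissipative relation in 𝓑, and A is maximal dissipative if and only if Ker(W_B) is a maximal dissipative relation in 𝓑. -/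
open scoped ComplexInnerProductSpace

noncomputable section

/-- A relation `R` in a Hilbert space `H` (a linear subspace of `H × H`) is dissipative
if `Re ⟪r₁, r₂⟫ ≤ 0` for all `(r₁, r₂) ∈ R`. -/
def IsDissipativeRel {H : Type*} [NormedAddCommGroup H] [InnerProductSpace ℂ H]
    (R : Submodule ℂ (H × H)) : Prop :=
  ∀ r ∈ R, (⟪r.1, r.2⟫ : ℂ).re ≤ 0

/-- A relation is maximal dissipative if it is dissipative and has no proper extension to a
dissipative relation. -/
def IsMaximalDissipativeRel {H : Type*} [NormedAddCommGroup H] [InnerProductSpace ℂ H]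
    (R : Submodule ℂ (H × H)) : Prop :=
  IsDissipativeRel R ∧
    ∀ R' : Submodule ℂ (H × H), IsDissipativeRel R' → R ≤ R' → R' = R

/-- A neutral vector of a dissipative relation is orthogonal to the whole relation with respect to
the form `(p, q) ↦ ⟪p.1, q.2⟫ + ⟪p.2, q.1⟫`. -/
theorem IsDissipativeRel.inner_add_inner_eq_zero
    {H : Type*} [NormedAddCommGroup H] [InnerProductSpace ℂ H]
    {R : Submodule ℂ (H × H)} (hR : IsDissipativeRel R) {p q : H × H}
    (hp : p ∈ R) (hq : q ∈ R) (hp0 : (⟪p.1, p.2⟫ : ℂ).re = 0) :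
    ⟪p.1, q.2⟫ + ⟪p.2, q.1⟫ = 0 := by
  obtain ⟨z, hz⟩ : ∃ z, z = ⟪p.1, q.2⟫ + ⟪p.2, q.1⟫ := ⟨_, rfl⟩
  rw [← hz]
  by_contra hne
  have key (t : ℝ) : t * Complex.normSq z + (⟪q.1, q.2⟫ : ℂ).re ≤ 0 := by
    have h := hR _ (R.add_mem (R.smul_mem (t * z) hp) hq)
    have hconj : ⟪q.1, p.2⟫ = (starRingEnd ℂ) ⟪p.2, q.1⟫ := (inner_conj_symm _ _).symm
    simp only [Prod.fst_add, Prod.snd_add, Prod.smul_fst, Prod.smul_snd, inner_add_left,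
      inner_add_right, inner_smul_left, inner_smul_right, hconj] at h
    have hre : (⟪p.1, q.2⟫ : ℂ).re = z.re - (⟪p.2, q.1⟫ : ℂ).re := by simp [hz]
    have him : (⟪p.1, q.2⟫ : ℂ).im = z.im - (⟪p.2, q.1⟫ : ℂ).im := by simp [hz]
    simp only [Complex.add_re, Complex.add_im, Complex.mul_re, Complex.mul_im,
      Complex.conj_re, Complex.conj_im, Complex.ofReal_re, Complex.ofReal_im, map_mul,
      hp0, hre, him] at h
    rw [Complex.normSq_apply]
    linarith
  have h := key ((1 - (⟪q.1, q.2⟫ : ℂ).re) / Complex.normSq z)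
  rw [div_mul_cancel₀ _ (Complex.normSq_pos.2 hne).ne'] at h
  linarith

namespace LinearPMap

variable {X : Type*} [NormedAddCommGroup X] [InnerProductSpace ℂ X] {T : X →ₗ.[ℂ] X}

/-- An operator `T` with vanishing `Re ⟪T x, x⟫` satisfies `⟪T x, y⟫ + ⟪x, T y⟫ = 0`. -/
theorem inner_add_inner_eq_zero_of_skew
    (hT : ∀ x : T.domain, (⟪T x, (x : X)⟫ : ℂ).re = 0) (x y : T.domain) :
    ⟪T x, (y : X)⟫ + ⟪(x : X), T y⟫ = 0 := by
  have hT' (x : T.domain) : (⟪(x : X), T x⟫ : ℂ).re = 0 :=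
    (inner_re_symm (𝕜 := ℂ) _ _).trans (hT x)
  have hdiss : IsDissipativeRel T.graph := by
    rintro ⟨a, b⟩ hab
    obtain ⟨u, rfl, rfl⟩ := (mem_graph_iff _).1 hab
    exact (hT' u).le
  rw [add_comm]
  exact hdiss.inner_add_inner_eq_zero (T.mem_graph x) (T.mem_graph y) (hT' x)

variable [CompleteSpace X]

/-- A pair `(u, v)` with `⟪v, x⟫ = ⟪u, T x⟫` for all `x` belongs to the graph of `T*`. -/
theorem mem_graph_adjoint_of_forall_inner_eq (hdense : Dense (T.domain : Set X)) {u v : X}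
    (h : ∀ x : T.domain, ⟪v, (x : X)⟫ = ⟪u, T x⟫) : (u, v) ∈ T.adjoint.graph :=
  (mem_graph_iff _).2 ⟨⟨u, mem_adjoint_domain_of_exists _ ⟨v, h⟩⟩, rfl,
    adjoint_apply_eq hdense _ h⟩

/-- A densely defined operator `T` with vanishing `Re ⟪T x, x⟫` satisfies `-T ⊆ T*`. -/
theorem mem_graph_adjoint_of_skew (hdense : Dense (T.domain : Set X))
    (hT : ∀ x : T.domain, (⟪T x, (x : X)⟫ : ℂ).re = 0) (x : T.domain) :
    ((x : X), -T x) ∈ T.adjoint.graph :=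
  mem_graph_adjoint_of_forall_inner_eq hdense fun y => by
    rw [inner_neg_left]
    linear_combination -inner_add_inner_eq_zero_of_skew hT x y

/-- A dissipative relation containing `-T`, with `T` skew-symmetric, is contained in `T*`. -/
theorem le_graph_adjoint_of_isDissipativeRel (hdense : Dense (T.domain : Set X))
    (hT : ∀ x : T.domain, (⟪T x, (x : X)⟫ : ℂ).re = 0) {R : Submodule ℂ (X × X)}
    (hR : IsDissipativeRel R) (hTR : ∀ x : T.domain, ((x : X), -T x) ∈ R) :
    R ≤ T.adjoint.graph := by
  rintro ⟨u, v⟩ huv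
  refine mem_graph_adjoint_of_forall_inner_eq hdense fun x => ?_
  have hneutral : (⟪(x : X), -T x⟫ : ℂ).re = 0 := by
    rw [inner_neg_right, Complex.neg_re, neg_eq_zero]
    exact (inner_re_symm (𝕜 := ℂ) _ _).trans (hT x)
  have h := hR.inner_add_inner_eq_zero (hTR x) huv hneutral
  simp only [inner_neg_left] at h
  rw [← inner_conj_symm v, ← inner_conj_symm u, add_neg_eq_zero.1 h]

end LinearPMap

namespace BoundaryTriplet

variable {X : Type*} [NormedAddCommGroup X] [InnerProductSpace ℂ X]
  {B : Type*} [NormedAddCommGroup B] [InnerProductSpace ℂ B]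
  {T : X →ₗ.[ℂ] X} (BT : BoundaryTriplet B T)

theorem re_inner_apply (x : T.domain) :
    (⟪(x : X), T x⟫ : ℂ).re = (⟪BT.B₁ x, BT.B₂ x⟫ : ℂ).re := by
  have h := congrArg Complex.re (BT.green x x)
  have h₁ : (⟪T x, (x : X)⟫ : ℂ).re = (⟪(x : X), T x⟫ : ℂ).re := inner_re_symm (𝕜 := ℂ) _ _
  have h₂ : (⟪BT.B₂ x, BT.B₁ x⟫ : ℂ).re = (⟪BT.B₁ x, BT.B₂ x⟫ : ℂ).re :=
    inner_re_symm (𝕜 := ℂ) _ _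
  simp only [Complex.add_re] at h
  linarith

/-- A vector which is orthogonal to the whole graph of `T` with respect to the form in Green's
identity has zero boundary values. -/
theorem boundary_eq_zero {x : T.domain}
    (h : ∀ y : T.domain, ⟪T x, (y : X)⟫ + ⟪(x : X), T y⟫ = 0) :
    BT.B₁ x = 0 ∧ BT.B₂ x = 0 := by
  obtain ⟨y, hy⟩ := BT.surjective (0, BT.B₁ x)
  obtain ⟨z, hz⟩ := BT.surjective (BT.B₂ x, 0)
  obtain ⟨hy₁, hy₂⟩ := Prod.mk.inj hy
  obtain ⟨hz₁, hz₂⟩ := Prod.mk.inj hz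
  have hgy := (BT.green x y).symm.trans (h y)
  have hgz := (BT.green x z).symm.trans (h z)
  rw [hy₁, hy₂, inner_zero_right, add_zero] at hgy
  rw [hz₁, hz₂, inner_zero_right, zero_add] at hgz
  exact ⟨inner_self_eq_zero.1 hgy, inner_self_eq_zero.1 hgz⟩

/-- The restriction, as a relation, of `T` to the vectors with boundary values in `S`. -/
def restrict (S : Submodule ℂ (B × B)) : Submodule ℂ (X × X) :=
  (S.comap (BT.B₁.prod BT.B₂)).map (T.domain.subtype.prod T.toFun)

theorem mem_restrict {S : Submodule ℂ (B × B)} {r : X × X} :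
    r ∈ BT.restrict S ↔ ∃ x : T.domain, (BT.B₁ x, BT.B₂ x) ∈ S ∧ ((x : X), T x) = r :=
  Iff.rfl

theorem mk_mem_restrict {S : Submodule ℂ (B × B)} {x : T.domain} :
    ((x : X), T x) ∈ BT.restrict S ↔ (BT.B₁ x, BT.B₂ x) ∈ S := by
  refine ⟨fun h => ?_, fun h => ⟨x, h, rfl⟩⟩
  obtain ⟨y, hy, hxy⟩ := BT.mem_restrict.1 h
  rwa [← show y = x from Subtype.ext (congrArg Prod.fst hxy)]

theorem restrict_le_restrict {S S' : Submodule ℂ (B × B)} :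
    BT.restrict S ≤ BT.restrict S' ↔ S ≤ S' := by
  refine ⟨fun h s hs => ?_, fun h => Submodule.map_mono (Submodule.comap_mono h)⟩
  obtain ⟨x, rfl⟩ := BT.surjective s
  exact BT.mk_mem_restrict.1 (h (BT.mk_mem_restrict.2 hs))

theorem isDissipativeRel_restrict_iff {S : Submodule ℂ (B × B)} :
    IsDissipativeRel (BT.restrict S) ↔ IsDissipativeRel S := by
  refine ⟨fun h s hs => ?_, ?_⟩
  · obtain ⟨x, rfl⟩ := BT.surjective s
    exact (BT.re_inner_apply x).symm.trans_le (h _ (BT.mk_mem_restrict.2 hs))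
  · rintro h _ ⟨x, hx, rfl⟩
    exact (BT.re_inner_apply x).trans_le (h _ hx)

/-- The relation of the boundary values of the elements of `R` in the graph of `T`. -/
def boundaryRel (R : Submodule ℂ (X × X)) : Submodule ℂ (B × B) :=
  (R.comap (T.domain.subtype.prod T.toFun)).map (BT.B₁.prod BT.B₂)

theorem isDissipativeRel_boundaryRel {R : Submodule ℂ (X × X)} (hR : IsDissipativeRel R) :
    IsDissipativeRel (BT.boundaryRel R) := by
  rintro _ ⟨x, hx, rfl⟩
  exact (BT.re_inner_apply x).symm.trans_le (hR _ hx)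

theorem le_restrict_boundaryRel {R : Submodule ℂ (X × X)} (hR : R ≤ T.graph) :
    R ≤ BT.restrict (BT.boundaryRel R) := by
  intro r hr
  obtain ⟨x, rfl⟩ := (LinearPMap.mem_graph_iff' _).1 (hR hr)
  exact BT.mk_mem_restrict.2 ⟨x, hr, rfl⟩

theorem le_boundaryRel {S : Submodule ℂ (B × B)} {R : Submodule ℂ (X × X)}
    (h : BT.restrict S ≤ R) : S ≤ BT.boundaryRel R := by
  intro s hs
  obtain ⟨x, rfl⟩ := BT.surjective s
  exact ⟨x, h (BT.mk_mem_restrict.2 hs), rfl⟩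

/-- The operator `-A₀` is contained in every restriction of `A₀*` by boundary conditions. -/
theorem mem_restrict_of_skew [CompleteSpace X] {A₀ : X →ₗ.[ℂ] X}
    (BT : BoundaryTriplet B A₀.adjoint) (hdense : Dense (A₀.domain : Set X))
    (hskew : ∀ x : A₀.domain, (⟪A₀ x, (x : X)⟫ : ℂ).re = 0)
    (S : Submodule ℂ (B × B)) (x : A₀.domain) : ((x : X), -A₀ x) ∈ BT.restrict S := by
  obtain ⟨u, hu, hAu⟩ :=
    (LinearPMap.mem_graph_iff _).1 (LinearPMap.mem_graph_adjoint_of_skew hdense hskew x)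
  simp only at hu hAu
  obtain ⟨h₁, h₂⟩ := BT.boundary_eq_zero (x := u) fun y => by
    rw [hAu, hu, inner_neg_left, ← inner_conj_symm (x : X),
      LinearPMap.adjoint_isFormalAdjoint hdense y x, inner_conj_symm, neg_add_cancel]
  rw [← hu, ← hAu, BT.mk_mem_restrict, h₁, h₂]
  exact S.zero_mem

theorem isMaximalDissipativeRel_restrict_iff [CompleteSpace X] {A₀ : X →ₗ.[ℂ] X}
    (BT : BoundaryTriplet B A₀.adjoint) (hdense : Dense (A₀.domain : Set X))
    (hskew : ∀ x : A₀.domain, (⟪A₀ x, (x : X)⟫ : ℂ).re = 0) {S : Submodule ℂ (B × B)} :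
    IsMaximalDissipativeRel (BT.restrict S) ↔ IsMaximalDissipativeRel S := by
  refine and_congr BT.isDissipativeRel_restrict_iff ⟨fun h S' hS' hle => ?_, fun h R hR hle => ?_⟩
  · exact le_antisymm (BT.restrict_le_restrict.1
      (h _ (BT.isDissipativeRel_restrict_iff.2 hS') (BT.restrict_le_restrict.2 hle)).le) hle
  · have hgraph : R ≤ A₀.adjoint.graph :=
      LinearPMap.le_graph_adjoint_of_isDissipativeRel hdense hskew hR fun x =>
        hle (BT.mem_restrict_of_skew hdense hskew S x)
    have hS := h _ (BT.isDissipativeRel_boundaryRel hR) (BT.le_boundaryRel hle)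
    exact le_antisymm ((BT.le_restrict_boundaryRel hgraph).trans_eq (by rw [hS])) hle

theorem graph_domRestrict (S : Submodule ℂ (B × B)) :
    (T.domRestrict ((S.comap (BT.B₁.prod BT.B₂)).map T.domain.subtype)).graph =
      BT.restrict S := by
  ext r
  rw [LinearPMap.mem_graph_iff', BT.mem_restrict]
  constructor
  · rintro ⟨⟨_, ⟨x, hx, rfl⟩, hx'⟩, rfl⟩
    exact ⟨x, hx, rfl⟩
  · rintro ⟨x, hx, rfl⟩
    exact ⟨⟨x, ⟨x, hx, rfl⟩, x.2⟩, rfl⟩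

end BoundaryTriplet

/-- With `A` the restriction of `A₀*` to `{x : W₁ B₁ x + W₂ B₂ x = 0}`,
`A` is (maximal) dissipative iff `ker W_B = {(f, e) : W₁ f + W₂ e = 0}` is a (maximal)
dissipative relation in `𝓑`. -/
theorem statement7
    {X : Type*} [NormedAddCommGroup X] [InnerProductSpace ℂ X] [CompleteSpace X]
    {B : Type*} [NormedAddCommGroup B] [InnerProductSpace ℂ B] [CompleteSpace B]
    {K : Type*} [NormedAddCommGroup K] [InnerProductSpace ℂ K] [CompleteSpace K]
    (A₀ : X →ₗ.[ℂ] X) (hdense : Dense (A₀.domain : Set X)) (hclosed : A₀.IsClosed)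
    (hskew : ∀ x : A₀.domain, (⟪A₀ x, (x : X)⟫ : ℂ).re = 0)
    (BT : BoundaryTriplet B A₀.adjoint)
    (W₁ W₂ : B →L[ℂ] K)
    (A : X →ₗ.[ℂ] X)
    (hA : A = A₀.adjoint.domRestrict
      ((LinearMap.ker ((W₁ : B →ₗ[ℂ] K) ∘ₗ BT.B₁ + (W₂ : B →ₗ[ℂ] K) ∘ₗ BT.B₂)).map
        A₀.adjoint.domain.subtype))
    (KerWB : Submodule ℂ (B × B))
    (hKer : KerWB = LinearMap.ker ((W₁ : B →ₗ[ℂ] K).coprod (W₂ : B →ₗ[ℂ] K))) :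
    (IsDissipativeRel A.graph ↔ IsDissipativeRel KerWB) ∧
      (IsMaximalDissipativeRel A.graph ↔ IsMaximalDissipativeRel KerWB) := by
  have hgraph : A.graph = BT.restrict KerWB := by
    rw [hA, hKer, ← BT.graph_domRestrict]
    rfl
  rw [hgraph]
  exact ⟨BT.isDissipativeRel_restrict_iff, BT.isMaximalDissipativeRel_restrict_iff hdense hskew⟩
end
end

section
/- Let 𝓒 be a maximal dissipative relation in a Hilbert space 𝓑. Then {e − f : (f, e) ∈ 𝓒} = 𝓑 and the map V : e − f ↦ e + f, for (f, e) ∈ 𝓒, is a well-defined linear contraction on all of 𝓑 (i.e., if (f, e), (f', e') ∈ 𝓒 and e − f = e' − f', then e + f = e' + f', and ‖e + f‖ ≤ ‖e − f‖ for all (f, e) ∈ 𝓒). -/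
open scoped ComplexInnerProductSpace

noncomputable section

/-- If `‖f x‖ ≤ ‖e x‖` for all `x`, then `f` factors through `e` via a contraction defined on the
whole Hilbert space. -/
theorem LinearMap.exists_contraction_apply_eq {E H F : Type*} [AddCommGroup E] [Module ℂ E]
    [NormedAddCommGroup H] [InnerProductSpace ℂ H] [CompleteSpace H]
    [NormedAddCommGroup F] [NormedSpace ℂ F] [CompleteSpace F]
    (e : E →ₗ[ℂ] H) (f : E →ₗ[ℂ] F) (hfe : ∀ x, ‖f x‖ ≤ ‖e x‖) :
    ∃ W : H →L[ℂ] F, (∀ x, W (e x) = f x) ∧ ∀ y, ‖W y‖ ≤ ‖y‖ := by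
  let K : Submodule ℂ H := (LinearMap.range e).topologicalClosure
  have : CompleteSpace K :=
    (Submodule.isClosed_topologicalClosure _).completeSpace_coe
  let e' : E →ₗ[ℂ] K := e.codRestrict K fun x ↦
    Submodule.le_topologicalClosure _ (LinearMap.mem_range_self e x)
  have hdense : DenseRange e' := by
    intro y
    rw [closure_subtype, ← Set.range_comp]
    exact y.2
  have hnorm : ∀ x, ‖f x‖ ≤ 1 * ‖e' x‖ := fun x ↦ (hfe x).trans_eq (one_mul _).symm
  refine ⟨(f.extendOfNorm e').comp K.orthogonalProjectionOnto, fun x ↦ ?_, fun y ↦ ?_⟩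
  · have hx : K.orthogonalProjectionOnto (e x) = e' x :=
      K.orthogonalProjectionOnto_mem_subspace_eq_self (e' x)
    rw [ContinuousLinearMap.comp_apply, hx]
    exact LinearMap.extendOfNorm_eq hdense ⟨1, hnorm⟩ x
  · exact (LinearMap.norm_extendOfNorm_apply_le hdense 1 hnorm _).trans
      ((one_mul _).trans_le (K.norm_orthogonalProjectionOnto_apply_le y))

theorem re_inner_nonpos_iff_norm_add_le_norm_sub {H : Type*} [NormedAddCommGroup H]
    [InnerProductSpace ℂ H] (f e : H) :
    (⟪f, e⟫ : ℂ).re ≤ 0 ↔ ‖e + f‖ ≤ ‖e - f‖ := by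
  have h₁ := norm_add_sq (𝕜 := ℂ) f e
  have h₂ := norm_sub_sq (𝕜 := ℂ) f e
  rw [add_comm f e] at h₁
  rw [norm_sub_rev f e] at h₂
  simp only [RCLike.re_to_complex] at h₁ h₂
  rw [← sq_le_sq₀ (norm_nonneg _) (norm_nonneg _)]
  constructor <;> intro h <;> linarith

/-- The inverse Cayley transform of a contraction `W`, as a relation: all pairs `(f, e)` with
`e + f = W (e - f)`. -/
def inverseCayley {H : Type*} [NormedAddCommGroup H] [InnerProductSpace ℂ H]
    (W : H →L[ℂ] H) : Submodule ℂ (H × H) :=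
  LinearMap.eqLocus (LinearMap.snd ℂ H H + LinearMap.fst ℂ H H)
    (W.toLinearMap ∘ₗ (LinearMap.snd ℂ H H - LinearMap.fst ℂ H H))

theorem mem_inverseCayley {H : Type*} [NormedAddCommGroup H] [InnerProductSpace ℂ H]
    {W : H →L[ℂ] H} {p : H × H} : p ∈ inverseCayley W ↔ p.2 + p.1 = W (p.2 - p.1) :=
  Iff.rfl

theorem isDissipativeRel_inverseCayley {H : Type*} [NormedAddCommGroup H]
    [InnerProductSpace ℂ H] {W : H →L[ℂ] H} (hW : ∀ y, ‖W y‖ ≤ ‖y‖) :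
    IsDissipativeRel (inverseCayley W) := by
  intro p hp
  rw [re_inner_nonpos_iff_norm_add_le_norm_sub, mem_inverseCayley.1 hp]
  exact hW _

/-- A maximal dissipative relation is the inverse Cayley transform of a contraction. -/
theorem IsMaximalDissipativeRel.exists_eq_inverseCayley {H : Type*} [NormedAddCommGroup H]
    [InnerProductSpace ℂ H] [CompleteSpace H] {R : Submodule ℂ (H × H)}
    (hR : IsMaximalDissipativeRel R) :
    ∃ W : H →L[ℂ] H, (∀ y, ‖W y‖ ≤ ‖y‖) ∧ R = inverseCayley W := by
  obtain ⟨W, hWR, hW⟩ := LinearMap.exists_contraction_apply_eq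
    ((LinearMap.snd ℂ H H - LinearMap.fst ℂ H H) ∘ₗ R.subtype)
    ((LinearMap.snd ℂ H H + LinearMap.fst ℂ H H) ∘ₗ R.subtype)
    fun p ↦ (re_inner_nonpos_iff_norm_add_le_norm_sub _ _).1 (hR.1 p p.2)
  exact ⟨W, hW, (hR.2 _ (isDissipativeRel_inverseCayley hW)
    fun p hp ↦ (hWR ⟨p, hp⟩).symm).symm⟩

/-- For a maximal dissipative relation `𝓒` in a Hilbert space `𝓑`:
`{e − f : (f, e) ∈ 𝓒} = 𝓑`, and `V : e − f ↦ e + f` is a well-defined linear contraction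
on all of `𝓑`. -/
theorem statement15
    {B : Type*} [NormedAddCommGroup B] [InnerProductSpace ℂ B] [CompleteSpace B]
    (𝓒 : Submodule ℂ (B × B)) (h𝓒 : IsMaximalDissipativeRel 𝓒) :
    (∀ b : B, ∃ p ∈ 𝓒, p.2 - p.1 = b) ∧
      (∀ p ∈ 𝓒, ∀ q ∈ 𝓒, p.2 - p.1 = q.2 - q.1 → p.2 + p.1 = q.2 + q.1) ∧
      (∀ p ∈ 𝓒, ‖p.2 + p.1‖ ≤ ‖p.2 - p.1‖) := by
  obtain ⟨W, hW, rfl⟩ := h𝓒.exists_eq_inverseCayley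
  refine ⟨fun b ↦ ⟨((2⁻¹ : ℂ) • (W b - b), (2⁻¹ : ℂ) • (W b + b)), ?_, ?_⟩, ?_, ?_⟩
  · have hb : (2⁻¹ : ℂ) • (W b + b) - (2⁻¹ : ℂ) • (W b - b) = b := by module
    rw [mem_inverseCayley, hb]
    module
  · module
  · intro p hp q hq hpq
    rw [mem_inverseCayley.1 hp, mem_inverseCayley.1 hq, hpq]
  · intro p hp
    exact (re_inner_nonpos_iff_norm_add_le_norm_sub _ _).1 (h𝓒.1 p hp)
end
end
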